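/- Let α be a rewb over Σ and let p be a nonempty prefix of some string in Ref(α); write p° for p with its last character erased. If the last character of p is [_i then i ∉ open(p°), and if the last character of p is ]_i then i ∈ open(p°). -/

import Mathlib

namespace Rewbs

/-- Extended alphabet Δ = Σ ⊎ B ⊎ ℕ⁺ : ordinary characters, brackets `[_i`, `]_i`,
and number characters (references). -/
inductive RSym (A : Type) : Type where
  | ch : A → RSym A
  | open_ : ℕ+ → RSym A
  | close : ℕ+ → RSym A
  | ref : ℕ+ → RSym A

/-- The alphabet Σ ⊎ B (no number characters). -/
inductive BSym (A : Type) : Type where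
  | ch : A → BSym A
  | open_ : ℕ+ → BSym A
  | close : ℕ+ → BSym A

/-- The homomorphism g : (Σ ⊎ B)* → Σ* erasing brackets. -/
def projB {A : Type} (v : List (BSym A)) : List A :=
  v.filterMap fun c => match c with
    | .ch a => some a
    | _ => none

/-- The fetching function fet_i. -/
noncomputable def fet {A : Type} (i : ℕ+) (v : List (BSym A)) : List A :=
  letI : DecidableEq (BSym A) := Classical.decEq _
  if BSym.open_ i ∈ v then
    projB (((v.reverse.takeWhile (fun c => decide (c ≠ BSym.open_ i))).reverse).takeWhile
      (fun c => decide (c ≠ BSym.close i)))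
  else []

/-- One step of the pre-dereferencing function (processing one character, appended
at the right of the already-processed string). -/
noncomputable def derefStep {A : Type} (acc : List (BSym A)) : RSym A → List (BSym A)
  | .ch a => acc ++ [BSym.ch a]
  | .open_ i => acc ++ [BSym.open_ i]
  | .close i => acc ++ [BSym.close i]
  | .ref i => acc ++ (fet i acc).map BSym.ch

/-- The pre-dereferencing function D : Δ* → (Σ ⊎ B)*. -/
noncomputable def preDeref {A : Type} (v : List (RSym A)) : List (BSym A) :=
  v.foldl derefStep []

/-- μ_i = fet_i ∘ D. -/
noncomputable def mu {A : Type} (i : ℕ+) (v : List (RSym A)) : List A :=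
  fet i (preDeref v)

/-- deref = g ∘ D. -/
noncomputable def deref {A : Type} (v : List (RSym A)) : List A :=
  projB (preDeref v)

/-- One step of the `open` function. -/
def openStep {A : Type} (s : Finset ℕ+) : RSym A → Finset ℕ+
  | .open_ i => insert i s
  | .close i => s.erase i
  | _ => s

/-- open : Δ* → finite subsets of ℕ⁺. -/
def openSet {A : Type} (v : List (RSym A)) : Finset ℕ+ :=
  v.foldl openStep ∅

/-- Syntax of regular expressions with backreferences (rewb). -/
inductive Rewb (A : Type) : Type where
  | ch : A → Rewb A
  | eps : Rewb A
  | backref : ℕ+ → Rewb A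
  | cat : Rewb A → Rewb A → Rewb A
  | alt : Rewb A → Rewb A → Rewb A
  | star : Rewb A → Rewb A
  | grp : ℕ+ → Rewb A → Rewb A

/-- `hasIdx i α` : the capturing group `(_i )_i` or the reference `\i` occurs in α. -/
def hasIdx {A : Type} (i : ℕ+) : Rewb A → Prop
  | .ch _ => False
  | .eps => False
  | .backref j => j = i
  | .cat r s => hasIdx i r ∨ hasIdx i s
  | .alt r s => hasIdx i r ∨ hasIdx i s
  | .star r => hasIdx i r
  | .grp j r => j = i ∨ hasIdx i r

/-- Well-formedness of a rewb: in `(_i α)_i`, the body α contains neither the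
capturing group `(_i )_i` nor the reference `\i`. -/
def Rewb.WF {A : Type} : Rewb A → Prop
  | .ch _ => True
  | .eps => True
  | .backref _ => True
  | .cat r s => r.WF ∧ s.WF
  | .alt r s => r.WF ∧ s.WF
  | .star r => r.WF
  | .grp i r => r.WF ∧ ¬ hasIdx i r

/-- The ref-language Ref(α) ⊆ Δ*. -/
def Ref {A : Type} : Rewb A → Language (RSym A)
  | .ch a => {[RSym.ch a]}
  | .eps => 1
  | .backref i => {[RSym.ref i]}
  | .cat r s => Ref r * Ref s
  | .alt r s => Ref r + Ref s
  | .star r => KStar.kstar (Ref r)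
  | .grp i r => ({[RSym.open_ i]} : Language (RSym A)) * Ref r * ({[RSym.close i]} : Language (RSym A))

/-- The language of a rewb: L(α) = deref(Ref(α)). -/
noncomputable def rewbLang {A : Type} (r : Rewb A) : Set (List A) :=
  deref '' (Ref r : Set (List (RSym A)))

/-- capt(α): the set of indices guaranteed to be captured. -/
def capt {A : Type} : Rewb A → Set ℕ+
  | .ch _ => ∅
  | .eps => ∅
  | .backref _ => ∅
  | .cat r s => capt r ∪ capt s
  | .alt r s => capt r ∩ capt s
  | .star r => capt r
  | .grp i r => capt r ∪ {i}

/-- The relation S ⊢ α. -/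
def Sat {A : Type} : Rewb A → Set ℕ+ → Prop
  | .ch _, _ => True
  | .eps, _ => True
  | .backref i, S => i ∈ S
  | .cat r s, S => Sat r S ∧ Sat s (S ∪ capt r)
  | .alt r s, S => Sat r S ∧ Sat s S
  | .star r, S => Sat r S
  | .grp _ r, S => Sat r S

/-- A rewb is closed if ∅ ⊢ α. -/
def Rewb.Closed {A : Type} (r : Rewb A) : Prop := Sat r ∅

/-- A rewb is closed-star if the body of every starred subexpression is closed. -/
def Rewb.ClosedStar {A : Type} : Rewb A → Prop
  | .ch _ => True
  | .eps => True
  | .backref _ => True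
  | .cat r s => r.ClosedStar ∧ s.ClosedStar
  | .alt r s => r.ClosedStar ∧ s.ClosedStar
  | .star r => r.ClosedStar ∧ r.Closed
  | .grp _ r => r.ClosedStar

/-- All indices (number characters and capturing-group indices) occurring in α are ≤ κ. -/
def Rewb.IdxLe {A : Type} (κ : ℕ) : Rewb A → Prop
  | .ch _ => True
  | .eps => True
  | .backref i => (i : ℕ) ≤ κ
  | .cat r s => r.IdxLe κ ∧ s.IdxLe κ
  | .alt r s => r.IdxLe κ ∧ s.IdxLe κ
  | .star r => r.IdxLe κ
  | .grp i r => (i : ℕ) ≤ κ ∧ r.IdxLe κ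

/-- All indices occurring in a character of Δ are ≤ κ. -/
def RSym.idxLe {A : Type} (κ : ℕ) : RSym A → Prop
  | .ch _ => True
  | .open_ i => (i : ℕ) ≤ κ
  | .close i => (i : ℕ) ≤ κ
  | .ref i => (i : ℕ) ≤ κ

/-! ### The tuple functions φ used in the unary-PMCFG construction -/

/-- The ℕ⁺ index corresponding to `j : Fin κ` (memory cell j+1). -/
def toP {κ : ℕ} (j : Fin κ) : ℕ+ := ⟨j.1 + 1, Nat.succ_pos _⟩

/-- φ_c^M : the input/paste/reset/identity functions on (κ+1)-tuples of strings. -/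
def phi {A : Type} (κ : ℕ) (M : Finset ℕ+) :
    RSym A → (List A × (Fin κ → List A)) → (List A × (Fin κ → List A))
  | RSym.ch a, (x, y) => (x ++ [a], fun j => if toP j ∈ M then y j ++ [a] else y j)
  | RSym.ref k, (x, y) =>
      let yk : List A := if h : k.1 ≤ κ ∧ 1 ≤ k.1 then y ⟨k.1 - 1, by omega⟩ else []
      (x ++ yk, fun j => if toP j ∈ M then y j ++ yk else y j)
  | RSym.open_ k, (x, y) => (x, fun j => if toP j = k then [] else y j)
  | RSym.close _, t => t

/-- Apply the functions φ_{v_r}^{open(prefix·v₁⋯v_r)} successively, left to right,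
where `pref` is the already-processed prefix. -/
noncomputable def derefRun {A : Type} (κ : ℕ) :
    List (RSym A) → List (RSym A) → (List A × (Fin κ → List A)) → (List A × (Fin κ → List A))
  | _, [], t => t
  | pref, c :: rest, t => derefRun κ (pref ++ [c]) rest (phi κ (openSet (pref ++ [c])) c t)

/-! ### The quantities t and s -/

/-- One (right-to-left) step of the t-sequence. -/
def tStep {A : Type} (c : RSym A) (t : ℕ+ → ℕ) : ℕ+ → ℕ :=
  match c with
  | .ch _ => t
  | .close _ => t
  | .open_ j => fun k => if k = j then 0 else t k
  | .ref j => fun k => if k = j then t k + 1 else t k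

/-- `tOf suf k` is t_{i,k} where `suf` is the suffix v_{i+1} ⋯ v_m of v. -/
def tOf {A : Type} : List (RSym A) → ℕ+ → ℕ
  | [] => fun _ => 0
  | c :: rest => tStep c (tOf rest)

/-- One (right-to-left) step of the s-sequence; `O` is open(v₁⋯v_i). -/
def sStep {A : Type} (O : Finset ℕ+) (c : RSym A) (s : ℕ+ → ℕ) : ℕ+ → ℕ :=
  match c with
  | .ch _ => s
  | .close _ => s
  | .open_ j => fun k => if k = j then 0 else s k
  | .ref j => fun k => if k = j then max (max 1 (s j)) (O.sup fun l => s l + 1) else s k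

/-- `sOf pref suf k` is s_{i,k} where v = pref ++ suf and i = |pref|. -/
def sOf {A : Type} : List (RSym A) → List (RSym A) → ℕ+ → ℕ
  | _, [] => fun _ => 0
  | pref, c :: rest => sStep (openSet (pref ++ [c])) c (sOf (pref ++ [c]) rest)

/-! ### Parallel multiple context-free grammars -/

/-- An item of an output component of a PMCFG function: a constant string
or the j-th component of the i-th argument. -/
inductive PItem (T : Type) : Type where
  | const : List T → PItem T
  | arg : ℕ → ℕ → PItem T

/-- A rule A → f[A₁,…,A_l] of a PMCFG, where f is given syntactically by the
lists of items of its output components. -/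
structure PRule (T N : Type) : Type where
  lhs : N
  rhs : List N
  out : List (List (PItem T))

/-- A PMCFG with nonterminals `Fin n`. -/
structure PMCFG (T : Type) : Type where
  n : ℕ
  dim : Fin n → ℕ
  start : Fin n
  rules : List (PRule T (Fin n))

/-- Evaluation of a single item, given the tuples derived from the arguments. -/
def evalItem {T : Type} (args : List (List (List T))) : PItem T → List T
  | .const c => c
  | .arg i j => (args.getD i []).getD j []

/-- Evaluation of one output component. -/
def evalItems {T : Type} (args : List (List (List T))) (items : List (PItem T)) : List T :=
  (items.map (evalItem args)).flatten

/-- The set L_G(A) of tuples derived from each nonterminal. -/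
inductive PMCFG.Derives {T : Type} (G : PMCFG T) : Fin G.n → List (List T) → Prop
  | step (r : PRule T (Fin G.n)) (hr : r ∈ G.rules) (args : List (List (List T)))
      (hargs : List.Forall₂ G.Derives r.rhs args) :
      G.Derives r.lhs (r.out.map (evalItems args))

/-- L(G) = L_G(S), identifying 1-tuples with strings. -/
def PMCFG.lang {T : Type} (G : PMCFG T) : Set (List T) :=
  {w | G.Derives G.start [w]}

/-- Well-formedness of a rule with respect to the dimension assignment. -/
def PRule.WFdim {T N : Type} (dim : N → ℕ) (r : PRule T N) : Prop :=
  r.out.length = dim r.lhs ∧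
  ∀ items ∈ r.out, ∀ it ∈ items, ∀ i j, it = PItem.arg i j →
    ∃ h : i < r.rhs.length, j < dim (r.rhs.get ⟨i, h⟩)

/-- G is a well-formed m-PMCFG. -/
def PMCFG.WF {T : Type} (G : PMCFG T) (m : ℕ) : Prop :=
  (∀ A : Fin G.n, 1 ≤ G.dim A ∧ G.dim A ≤ m) ∧ G.dim G.start = 1 ∧
  ∀ r ∈ G.rules, r.WFdim G.dim

/-- G is unary: every function takes at most one argument. -/
def PMCFG.Unary {T : Type} (G : PMCFG T) : Prop :=
  ∀ r ∈ G.rules, r.rhs.length ≤ 1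

/-- The list of argument components referenced by a rule. -/
def PRule.argRefs {T N : Type} (r : PRule T N) : List (ℕ × ℕ) :=
  r.out.flatten.filterMap fun it => match it with
    | .arg i j => some (i, j)
    | _ => none

/-- G is an MCFG: no rule uses the same argument component more than once. -/
def PMCFG.NonDup {T : Type} (G : PMCFG T) : Prop :=
  ∀ r ∈ G.rules, r.argRefs.Nodup

/-! ### Stack automata -/

/-- Direction of the stack pointer. -/
inductive SDir : Type where
  | left | stay | right
deriving DecidableEq

/-- A one-way nondeterministic stack automaton.  The input symbol `none`
denotes the endmarker ▷.  `push q a Z` is the pushdown mode (applicable when the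
stack pointer is at the top symbol Z; the Bool is whether the input head moves
right); `read q a Z top` is the stack-reading mode (`top` tells whether the
pointed symbol Z is the topmost one). -/
structure SA (T : Type) : Type 1 where
  Q : Type
  finQ : Fintype Q
  Γ : Type
  finΓ : Fintype Γ
  q0 : Q
  Z0 : Γ
  F : Set Q
  push : Q → Option T → Γ → Set (Q × Bool × List Γ)
  read : Q → Option T → Γ → Bool → Set (Q × Bool × SDir)

namespace SA

/-- Instantaneous description: state, remaining input (the endmarker ▷ is
implicit at the end), stack below-and-including the pointer, stack above the
pointer. -/
def Conf {T : Type} (M : SA T) : Type := M.Q × List T × List M.Γ × List M.Γ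

/-- Move the stack pointer: the stack is γ ++ [Z] ++ above with the pointer on Z. -/
def moveStack {Γ : Type} : SDir → List Γ → Γ → List Γ → List Γ × List Γ
  | .left, γ, Z, above => (γ, Z :: above)
  | .stay, γ, Z, above => (γ ++ [Z], above)
  | .right, γ, Z, b :: rest => (γ ++ [Z, b], rest)
  | .right, γ, Z, [] => (γ ++ [Z], [])

/-- One move of a stack automaton on instantaneous descriptions. -/
inductive Step {T : Type} (M : SA T) : M.Conf → M.Conf → Prop
  | push (q : M.Q) (u : List T) (γ : List M.Γ) (Z : M.Γ) (q' : M.Q) (d : Bool) (y : List M.Γ)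
      (hmem : (q', d, y) ∈ M.push q u.head? Z)
      (hd : d = true → u ≠ []) :
      Step M (q, u, γ ++ [Z], []) (q', if d then u.tail else u, γ ++ y, [])
  | read (q : M.Q) (u : List T) (γ : List M.Γ) (Z : M.Γ) (above : List M.Γ)
      (q' : M.Q) (d : Bool) (e : SDir)
      (hmem : (q', d, e) ∈ M.read q u.head? Z above.isEmpty)
      (hd : d = true → u ≠ [])
      (hleft : e = SDir.left → γ ≠ [])
      (hright : e = SDir.right → above ≠ []) :
      Step M (q, u, γ ++ [Z], above)
        (q', if d then u.tail else u, (moveStack e γ Z above).1, (moveStack e γ Z above).2)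

/-- Acceptance: from (q₀, w▷, Z₀↑$) reach a final state with the whole input read. -/
def Accepts {T : Type} (M : SA T) (w : List T) : Prop :=
  ∃ (qf : M.Q) (g1 g2 : List M.Γ), qf ∈ M.F ∧
    Relation.ReflTransGen (Step M) (M.q0, w, [M.Z0], []) (qf, [], g1, g2)

/-- The language of a stack automaton. -/
def lang {T : Type} (M : SA T) : Set (List T) := {w | M.Accepts w}

/-- Nonerasing: every pushdown-mode transition pushes a nonempty word. -/
def NonErasing {T : Type} (M : SA T) : Prop :=
  ∀ q a Z q' d y, (q', d, y) ∈ M.push q a Z → y ≠ []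

end SA

/-- Reading `c` with open indices `S` opens only a group that is not open and closes only a
group that is open. -/
def BracketOk {A : Type} (S : Finset ℕ+) (c : RSym A) : Prop :=
  (∀ i : ℕ+, c = RSym.open_ i → i ∉ S) ∧ (∀ i : ℕ+, c = RSym.close i → i ∈ S)

/-- Every character of the string is `BracketOk` when the string is read from open indices `S`. -/
def BracketRun {A : Type} : Finset ℕ+ → List (RSym A) → Prop
  | _, [] => True
  | S, c :: v => BracketOk S c ∧ BracketRun (openStep S c) v

theorem bracketRun_append {A : Type} (S : Finset ℕ+) (u v : List (RSym A)) :
    BracketRun S (u ++ v) ↔ BracketRun S u ∧ BracketRun (u.foldl openStep S) v := by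
  induction u generalizing S with
  | nil => simp [BracketRun]
  | cons c u ih => simp [BracketRun, ih, and_assoc]

/-- A string of the ref-language of a well-formed rewb, read from a set of open indices disjoint
from those of the rewb, is a valid run and restores that set. -/
theorem bracketRun_of_mem_ref {A : Type} (α : Rewb A) (hwf : α.WF) (w : List (RSym A))
    (hw : w ∈ Ref α) (S : Finset ℕ+) (hS : ∀ i, hasIdx i α → i ∉ S) :
    BracketRun S w ∧ w.foldl openStep S = S := by
  induction α generalizing w S with
  | ch a =>
    obtain rfl : w = [RSym.ch a] := hw
    simp [BracketRun, BracketOk, openStep]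
  | eps =>
    obtain rfl : w = [] := hw
    simp [BracketRun]
  | backref i =>
    obtain rfl : w = [RSym.ref i] := hw
    simp [BracketRun, BracketOk, openStep]
  | cat r s ihr ihs =>
    obtain ⟨u, hu, v, hv, rfl⟩ := Language.mem_mul.mp hw
    obtain ⟨hur, huS⟩ := ihr hwf.1 u hu S fun i hi => hS i (Or.inl hi)
    obtain ⟨hvr, hvS⟩ := ihs hwf.2 v hv S fun i hi => hS i (Or.inr hi)
    rw [bracketRun_append, List.foldl_append, huS]
    exact ⟨⟨hur, hvr⟩, hvS⟩
  | alt r s ihr ihs =>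
    rcases (Language.mem_add _ _ _).mp hw with h | h
    · exact ihr hwf.1 w h S fun i hi => hS i (Or.inl hi)
    · exact ihs hwf.2 w h S fun i hi => hS i (Or.inr hi)
  | star r ih =>
    obtain ⟨L, rfl, hL⟩ := Language.mem_kstar.mp hw
    clear hw
    induction L with
    | nil => simp [BracketRun]
    | cons u L ihL =>
      obtain ⟨hur, huS⟩ := ih hwf u (hL u List.mem_cons_self) S hS
      obtain ⟨hvr, hvS⟩ := ihL fun v hv => hL v (List.mem_cons_of_mem u hv)
      rw [List.flatten_cons, bracketRun_append, List.foldl_append, huS]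
      exact ⟨⟨hur, hvr⟩, hvS⟩
  | grp i r ih =>
    obtain ⟨_, ⟨_, rfl, v, hv, rfl⟩, _, rfl, rfl⟩ := hw
    have hi : i ∉ S := hS i (Or.inl rfl)
    obtain ⟨hvr, hvS⟩ := ih hwf.1 v hv (insert i S) fun j hj => by
      rw [Finset.mem_insert, not_or]
      exact ⟨fun h => hwf.2 (h ▸ hj), hS j (Or.inr hj)⟩
    simp [bracketRun_append, BracketRun, BracketOk, openStep, hvr, hvS, hi]

/-- Lemma opassert. -/
theorem stmt5 {A : Type} (α : Rewb A) (hwf : α.WF)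
    (w : List (RSym A)) (hw : w ∈ Ref α)
    (p : List (RSym A)) (c : RSym A) (hp : (p ++ [c]) <+: w) :
    (∀ i : ℕ+, c = RSym.open_ i → i ∉ openSet p) ∧
    (∀ i : ℕ+, c = RSym.close i → i ∈ openSet p) := by
  obtain ⟨v, rfl⟩ := hp
  have hrun := (bracketRun_of_mem_ref α hwf _ hw ∅ fun i _ => Finset.notMem_empty i).1
  rw [List.append_assoc, bracketRun_append] at hrun
  exact hrun.2.1

end Rewbs
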